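/- In the Artin braid group B_n (n ≥ 3), the element Δ² = (σ_1 σ_2 ⋯ σ_{n-1})^n generates the center of B_n. -/

import Mathlib

/-- Defining relations of the Artin braid group `B_n` on generators
`σ_1, …, σ_{n-1}` (indexed here by `Fin (n-1)`, with `σ_{i+1} =` generator `i`). -/
def braidRels (m : ℕ) : Set (FreeGroup (Fin m)) :=
  {w | (∃ i j : Fin m, (i : ℕ) + 2 ≤ (j : ℕ) ∧
          w = .of i * .of j * (.of i)⁻¹ * (.of j)⁻¹) ∨
       (∃ i j : Fin m, (i : ℕ) + 1 = (j : ℕ) ∧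
          w = .of i * .of j * .of i * (.of j * .of i * .of j)⁻¹)}

/-- The Artin braid group on `n` strands. -/
abbrev braidGroup (n : ℕ) := PresentedGroup (braidRels (n - 1))

/-- The standard Artin generator `σ_i` (1-based index `i ∈ [1, n-1]`). -/
def σ (n i : ℕ) : braidGroup n :=
  if h : i - 1 < n - 1 then PresentedGroup.of ⟨i - 1, h⟩ else 1



namespace BG

/-- adjacency of generator indices -/
def adj {m : ℕ} (i j : Fin m) : Prop := (i : ℕ) + 1 = j ∨ (j : ℕ) + 1 = i

theorem adj_symm {m : ℕ} {i j : Fin m} (h : adj i j) : adj j i := Or.symm h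

theorem adj_ne {m : ℕ} {i j : Fin m} (h : adj i j) : i ≠ j := by
  rintro rfl; unfold adj at h; omega

/-- positive braid equivalence of words -/
inductive BEq {m : ℕ} : List (Fin m) → List (Fin m) → Prop
  | refl (u) : BEq u u
  | symm {u v} : BEq u v → BEq v u
  | trans {u v w} : BEq u v → BEq v w → BEq u w
  | cons (i) {u v} : BEq u v → BEq (i :: u) (i :: v)
  | comm (i j : Fin m) (u) : (i : ℕ) + 2 ≤ j → BEq (i :: j :: u) (j :: i :: u)
  | braid (i j : Fin m) (u) : (i : ℕ) + 1 = j → BEq (i :: j :: i :: u) (j :: i :: j :: u)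

theorem BEq.length {m : ℕ} {u v : List (Fin m)} (h : BEq u v) : u.length = v.length := by
  induction h <;> simp_all

theorem BEq.append_left {m : ℕ} (w : List (Fin m)) {u v : List (Fin m)} (h : BEq u v) :
    BEq (w ++ u) (w ++ v) := by
  induction w with
  | nil => exact h
  | cons a w ih => exact .cons a ih

theorem BEq.append_right {m : ℕ} (w : List (Fin m)) {u v : List (Fin m)} (h : BEq u v) :
    BEq (u ++ w) (v ++ w) := by
  induction h with
  | refl => exact .refl _
  | symm _ ih => exact ih.symm
  | trans _ _ ih1 ih2 => exact ih1.trans ih2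
  | cons i _ ih => exact .cons i ih
  | comm i j u h => exact .comm i j _ h
  | braid i j u h => exact .braid i j _ h

theorem BEq.reverse {m : ℕ} {u v : List (Fin m)} (h : BEq u v) :
    BEq u.reverse v.reverse := by
  induction h with
  | refl => exact .refl _
  | symm _ ih => exact ih.symm
  | trans _ _ ih1 ih2 => exact ih1.trans ih2
  | cons i _ ih => simpa using ih.append_right _
  | comm i j u h =>
    simpa using BEq.append_left u.reverse (BEq.comm i j [] h).symm
  | braid i j u h =>
    simpa using BEq.append_left u.reverse (BEq.braid i j [] h)

/-- the setoid of positive braid equivalence -/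
def setoid (m : ℕ) : Setoid (List (Fin m)) := ⟨BEq, BEq.refl, BEq.symm, BEq.trans⟩

/-- the positive braid monoid on `m` generators -/
def M (m : ℕ) : Type := Quotient (setoid m)

/-- class of a word -/
def mk {m : ℕ} (u : List (Fin m)) : M m := Quotient.mk (setoid m) u

theorem mk_eq {m : ℕ} {u v : List (Fin m)} : mk u = mk v ↔ BEq u v :=
  ⟨fun h => Quotient.exact h, fun h => Quotient.sound h⟩

theorem mk_surj {m : ℕ} (x : M m) : ∃ u, mk u = x := Quotient.exists_rep x

instance (m : ℕ) : Mul (M m) :=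
  ⟨Quotient.map₂ (fun u v => u ++ v) (fun _ _ h _ _ h' =>
    BEq.trans (BEq.append_right _ h) (BEq.append_left _ h'))⟩

instance (m : ℕ) : One (M m) := ⟨mk []⟩

theorem mk_mul {m : ℕ} (u v : List (Fin m)) : mk u * mk v = mk (u ++ v) := rfl

theorem mk_nil {m : ℕ} : (mk [] : M m) = 1 := rfl

instance (m : ℕ) : Monoid (M m) where
  mul_assoc x y z := by
    obtain ⟨u, rfl⟩ := mk_surj x
    obtain ⟨v, rfl⟩ := mk_surj y
    obtain ⟨w, rfl⟩ := mk_surj z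
    simp only [mk_mul, List.append_assoc]
  one_mul x := by
    obtain ⟨u, rfl⟩ := mk_surj x
    rfl
  mul_one x := by
    obtain ⟨u, rfl⟩ := mk_surj x
    rw [← mk_nil, mk_mul, List.append_nil]

/-- length -/
def len {m : ℕ} : M m → ℕ := Quotient.lift List.length (fun _ _ h => BEq.length h)

theorem len_mk {m : ℕ} (u : List (Fin m)) : len (mk u) = u.length := rfl

theorem len_mul {m : ℕ} (x y : M m) : len (x * y) = len x + len y := by
  obtain ⟨u, rfl⟩ := mk_surj x
  obtain ⟨v, rfl⟩ := mk_surj y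
  simp [mk_mul, len_mk]

theorem len_one {m : ℕ} : len (1 : M m) = 0 := rfl

/-- generator -/
def s {m : ℕ} (i : Fin m) : M m := mk [i]

theorem len_s {m : ℕ} (i : Fin m) : len (s i) = 1 := rfl

theorem mk_cons {m : ℕ} (i : Fin m) (u) : mk (i :: u) = s i * mk u := rfl

theorem eq_one_or {m : ℕ} (x : M m) : x = 1 ∨ ∃ i y, x = s i * y := by
  obtain ⟨u, rfl⟩ := mk_surj x
  cases u with
  | nil => exact .inl rfl
  | cons i u => exact .inr ⟨i, mk u, rfl⟩

theorem M_ind {m : ℕ} {p : M m → Prop} (h1 : p 1) (h : ∀ i x, p x → p (s i * x)) (x) : p x := by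
  obtain ⟨u, rfl⟩ := mk_surj x
  induction u with
  | nil => exact h1
  | cons i u ih => exact h i _ ih

theorem s_comm {m : ℕ} {i j : Fin m} (h : ¬ adj i j) : s i * s j = s j * s i := by
  unfold adj at h
  rcases lt_trichotomy (i : ℕ) j with h' | h' | h'
  · exact mk_eq.2 (BEq.comm i j [] (by omega))
  · rw [Fin.ext h']
  · exact (mk_eq.2 (BEq.comm j i [] (by omega))).symm

theorem s_braid {m : ℕ} {i j : Fin m} (h : adj i j) : s i * (s j * s i) = s j * (s i * s j) := by
  rcases h with h | h
  · exact mk_eq.2 (BEq.braid i j [] h)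
  · exact (mk_eq.2 (BEq.braid j i [] h)).symm

theorem s_comm' {m : ℕ} {i j : Fin m} (h : ¬ adj i j) (x : M m) :
    s i * (s j * x) = s j * (s i * x) := by
  rw [← mul_assoc, s_comm h, mul_assoc]

theorem s_braid' {m : ℕ} {i j : Fin m} (h : adj i j) (x : M m) :
    s i * (s j * (s i * x)) = s j * (s i * (s j * x)) := by
  have := congrArg (· * x) (s_braid h)
  simpa only [mul_assoc] using this

/-- the conclusion of Garside's key lemma -/
def C {m : ℕ} (i j : Fin m) (u v : M m) : Prop :=
  (i = j ∧ u = v) ∨ (i ≠ j ∧ ¬ adj i j ∧ ∃ z, u = s j * z ∧ v = s i * z) ∨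
  (adj i j ∧ ∃ z, u = s j * (s i * z) ∧ v = s i * (s j * z))

theorem C.symm {m : ℕ} {i j : Fin m} {u v : M m} (h : C i j u v) : C j i v u := by
  rcases h with ⟨h, h'⟩ | ⟨h, h', z, hz, hz'⟩ | ⟨h, z, hz, hz'⟩
  · exact .inl ⟨h.symm, h'.symm⟩
  · exact .inr (.inl ⟨h.symm, fun a => h' (adj_symm a), z, hz', hz⟩)
  · exact .inr (.inr ⟨adj_symm h, z, hz', hz⟩)

theorem C.cancel {m : ℕ} {i : Fin m} {u v : M m} (h : C i i u v) : u = v := by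
  rcases h with ⟨_, h'⟩ | ⟨h, _⟩ | ⟨h, _⟩
  · exact h'
  · exact (h rfl).elim
  · exact (adj_ne h rfl).elim

theorem C.com {m : ℕ} {i j : Fin m} {u v : M m} (h : C i j u v) (hij : i ≠ j) (ha : ¬ adj i j) :
    ∃ z, u = s j * z ∧ v = s i * z := by
  rcases h with ⟨h, h'⟩ | ⟨_, _, h⟩ | ⟨h, _⟩
  · exact (hij h).elim
  · exact h
  · exact (ha h).elim

theorem C.brd {m : ℕ} {i j : Fin m} {u v : M m} (h : C i j u v) (ha : adj i j) :
    ∃ z, u = s j * (s i * z) ∧ v = s i * (s j * z) := by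
  rcases h with ⟨h, h'⟩ | ⟨_, h, _⟩ | ⟨_, h⟩
  · exact (adj_ne ha h).elim
  · exact (h ha).elim
  · exact h

theorem C.trans' {m : ℕ} {L : ℕ}
    (IH : ∀ (i j : Fin m) (u v : M m), len u < L → s i * u = s j * v → C i j u v)
    {i j k : Fin m} {u v w : M m} (hv : len v = L) (h1 : C i j u v) (h2 : C j k v w) :
    C i k u w := by
  by_cases hij : i = j
  · subst hij; rw [h1.cancel]; exact h2
  by_cases hjk : j = k
  · subst hjk; rw [← h2.cancel]; exact h1
  by_cases hik : i = k
  · subst hik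
    refine .inl ⟨rfl, ?_⟩
    by_cases ha : adj i j
    · obtain ⟨z, rfl, rfl⟩ := h1.brd ha
      obtain ⟨z', h, rfl⟩ := h2.brd (adj_symm ha)
      simp only [len_mul, len_s] at hv
      have e1 := (IH _ _ _ _ (by simp only [len_mul, len_s]; omega) h).cancel
      have e2 := (IH _ _ _ _ (by omega) e1).cancel
      rw [e2]
    · obtain ⟨z, rfl, rfl⟩ := h1.com hij ha
      obtain ⟨z', h, rfl⟩ := h2.com (Ne.symm hij) (fun a => ha (adj_symm a))
      simp only [len_mul, len_s] at hv
      have e1 := (IH _ _ _ _ (by omega) h).cancel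
      rw [e1]
  by_cases aij : adj i j
  · have aji := adj_symm aij
    have bij := s_braid' aij
    obtain ⟨z, rfl, rfl⟩ := h1.brd aij
    simp only [len_mul, len_s] at hv
    by_cases ajk : adj j k
    · have akj := adj_symm ajk
      have aik : ¬ adj i k := by unfold adj at *; omega
      have aki : ¬ adj k i := by unfold adj at *; omega
      have bjk := s_braid' ajk
      have cik := s_comm' aik
      obtain ⟨z', h, rfl⟩ := h2.brd ajk
      obtain ⟨t, e1, e2⟩ := (IH _ _ _ _ (by simp only [len_mul, len_s]; omega) h).com hik aik
      have l1 := congrArg len e1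
      have l2 := congrArg len h
      simp only [len_mul, len_s] at l1 l2
      obtain ⟨q, rfl, e3⟩ := (IH _ _ _ _ (by omega) e1).brd ajk
      obtain ⟨q', rfl, e4⟩ := (IH _ _ _ _ (by omega) e2).brd aji
      rw [e3] at e4
      simp only [len_mul, len_s] at l1 l2 hv
      have e5 := (IH _ _ _ _ (by simp only [len_mul, len_s]; omega) e4).cancel
      obtain ⟨r, rfl, rfl⟩ := (IH _ _ _ _ (by omega) e5).com (Ne.symm hik) aki
      refine .inr (.inl ⟨hik, aik, s j * (s k * (s i * (s j * r))), ?_, ?_⟩)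
      · rw [cik, bij, ← bjk]
      · rw [← cik, ← bjk, ← bij, cik]
    · have akj : ¬ adj k j := fun a => ajk (adj_symm a)
      have cjk := s_comm' ajk
      obtain ⟨z', h, rfl⟩ := h2.com hjk ajk
      by_cases aik : adj i k
      · have aki := adj_symm aik
        have bik := s_braid' aik
        obtain ⟨t, e1, rfl⟩ := (IH _ _ _ _ (by simp only [len_mul, len_s]; omega) h).brd aik
        have l1 := congrArg len e1
        simp only [len_mul, len_s] at l1
        obtain ⟨q, rfl, e2⟩ := (IH _ _ _ _ (by omega) e1).com hjk ajk
        simp only [len_mul, len_s] at l1 hv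
        obtain ⟨r, rfl, rfl⟩ := (IH _ _ _ _ (by omega) e2).brd aij
        refine .inr (.inr ⟨aik, s j * (s i * (s k * r)), ?_, ?_⟩)
        · rw [bik, cjk, bij, cjk]
        · rw [← cjk, ← bij, bik, cjk]
      · have aki : ¬ adj k i := fun a => aik (adj_symm a)
        have cik := s_comm' aik
        obtain ⟨t, e1, rfl⟩ := (IH _ _ _ _ (by simp only [len_mul, len_s]; omega) h).com hik aik
        have l1 := congrArg len e1
        simp only [len_mul, len_s] at l1
        obtain ⟨q, rfl, rfl⟩ := (IH _ _ _ _ (by omega) e1).com hjk ajk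
        refine .inr (.inl ⟨hik, aik, s j * (s i * q), ?_, ?_⟩)
        · rw [cik, cjk]
        · rw [bij]
  · have aji : ¬ adj j i := fun a => aij (adj_symm a)
    have cij := s_comm' aij
    obtain ⟨z, rfl, rfl⟩ := h1.com hij aij
    simp only [len_mul, len_s] at hv
    by_cases ajk : adj j k
    · have akj := adj_symm ajk
      have bjk := s_braid' ajk
      obtain ⟨z', h, rfl⟩ := h2.brd ajk
      have l0 := congrArg len h
      simp only [len_mul, len_s] at l0
      by_cases aik : adj i k
      · have aki := adj_symm aik
        have bik := s_braid' aik
        obtain ⟨t, rfl, e1⟩ := (IH _ _ _ _ (by omega) h).brd aik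
        have l1 := congrArg len e1
        simp only [len_mul, len_s] at l1
        obtain ⟨q, rfl, e2⟩ := (IH _ _ _ _ (by omega) e1).com (Ne.symm hij) aji
        simp only [len_mul, len_s] at l1 hv
        obtain ⟨r, rfl, rfl⟩ := (IH _ _ _ _ (by omega) e2).brd akj
        refine .inr (.inr ⟨aik, s j * (s k * (s i * r)), ?_, ?_⟩)
        · rw [cij, bjk, ← bik, ← cij]
        · rw [← bik, ← bjk, cij r, cij (s k * (s j * (s i * r)))]
      · have aki : ¬ adj k i := fun a => aik (adj_symm a)
        have cik := s_comm' aik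
        obtain ⟨t, rfl, e1⟩ := (IH _ _ _ _ (by omega) h).com hik aik
        have l1 := congrArg len e1
        simp only [len_mul, len_s] at l1
        obtain ⟨q, rfl, rfl⟩ := (IH _ _ _ _ (by omega) e1).com (Ne.symm hij) aji
        refine .inr (.inl ⟨hik, aik, s j * (s k * q), ?_, ?_⟩)
        · rw [bjk]
        · rw [← cik, cij]
    · have akj : ¬ adj k j := fun a => ajk (adj_symm a)
      have cjk := s_comm' ajk
      obtain ⟨z', h, rfl⟩ := h2.com hjk ajk
      by_cases aik : adj i k
      · obtain ⟨t, rfl, rfl⟩ := (IH _ _ _ _ (by omega) h).brd aik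
        refine .inr (.inr ⟨aik, s j * t, ?_, ?_⟩)
        · rw [cjk, cij]
        · rw [← cij, cjk]
      · obtain ⟨t, rfl, rfl⟩ := (IH _ _ _ _ (by omega) h).com hik aik
        refine .inr (.inl ⟨hik, aik, s j * t, ?_, ?_⟩)
        · rw [cjk]
        · rw [cij]

/-- word version of `C` -/
def Cw {m : ℕ} : List (Fin m) → List (Fin m) → Prop
  | i :: u, j :: v => C i j (mk u) (mk v)
  | [], [] => True
  | _, _ => False

theorem BEq.key {m : ℕ} {L : ℕ}
    (IH : ∀ (i j : Fin m) (u v : M m), len u < L → s i * u = s j * v → C i j u v)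
    {u v : List (Fin m)} (h : BEq u v) : u.length = L + 1 → Cw u v := by
  induction h with
  | refl u =>
    intro _
    cases u with
    | nil => trivial
    | cons i u => exact .inl ⟨rfl, rfl⟩
  | @symm u v h ih =>
    intro hl
    have := ih (by rw [h.length, hl])
    cases u <;> cases v <;> first | exact this | exact C.symm this
  | @trans u v w h1 h2 ih1 ih2 =>
    intro hl
    have l1 := h1.length
    have l2 := h2.length
    have t1 := ih1 hl
    have t2 := ih2 (by omega)
    match u, v, w, t1, t2, hl, l1, l2 with
    | i :: u, j :: v, k :: w, t1, t2, hl, l1, l2 =>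
      exact C.trans' IH (by simp only [len_mk, List.length_cons] at *; omega) t1 t2
  | cons i h ih => exact fun _ => .inl ⟨rfl, mk_eq.2 h⟩
  | comm i j u h =>
    refine fun _ => .inr (.inl ⟨?_, ?_, mk u, rfl, rfl⟩)
    · rintro rfl; omega
    · unfold adj; omega
  | braid i j u h => exact fun _ => .inr (.inr ⟨.inl h, mk u, rfl, rfl⟩)

theorem key_aux {m : ℕ} (L : ℕ) : ∀ (i j : Fin m) (u v : M m), len u < L →
    s i * u = s j * v → C i j u v := by
  induction L with
  | zero => intro i j u v h; omega
  | succ L IH =>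
    intro i j x y h e
    by_cases hl : len x < L
    · exact IH _ _ _ _ hl e
    obtain ⟨u, rfl⟩ := mk_surj x
    obtain ⟨v, rfl⟩ := mk_surj y
    rw [← mk_cons, ← mk_cons, mk_eq] at e
    rw [len_mk] at *
    exact e.key IH (by simp only [List.length_cons]; omega)

theorem key {m : ℕ} {i j : Fin m} {u v : M m} (h : s i * u = s j * v) : C i j u v :=
  key_aux (len u + 1) i j u v (by omega) h

theorem cancel_left {m : ℕ} (x : M m) : ∀ {y z : M m}, x * y = x * z → y = z := by
  induction x using M_ind with
  | h1 => simp
  | h i x ih =>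
    intro y z h
    rw [mul_assoc, mul_assoc] at h
    exact ih (key h).cancel

/-- reversal -/
def rv {m : ℕ} : M m → M m := Quotient.map List.reverse (fun _ _ h => BEq.reverse h)

theorem rv_mul {m : ℕ} (x y : M m) : rv (x * y) = rv y * rv x := by
  obtain ⟨u, rfl⟩ := mk_surj x
  obtain ⟨v, rfl⟩ := mk_surj y
  change mk _ = mk _ * mk _
  simp [mk_mul]

theorem rv_rv {m : ℕ} (x : M m) : rv (rv x) = x := by
  obtain ⟨u, rfl⟩ := mk_surj x
  change mk _ = mk _
  simp

theorem cancel_right {m : ℕ} (x : M m) {y z : M m} (h : y * x = z * x) : y = z := by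
  have := congrArg rv h
  rw [rv_mul, rv_mul] at this
  rw [← rv_rv y, cancel_left _ this, rv_rv]

/-- generator indexed by a natural number -/
def g (m k : ℕ) : M m := if h : k < m then s ⟨k, h⟩ else 1

theorem g_eq {m k : ℕ} (h : k < m) : g m k = s ⟨k, h⟩ := dif_pos h

theorem s_eq_g {m : ℕ} (i : Fin m) : s i = g m i := (g_eq i.2).symm

theorem g_comm {m k l : ℕ} (h : k + 2 ≤ l) : g m k * g m l = g m l * g m k := by
  unfold g
  split_ifs
  · exact s_comm (by unfold adj; simp only; omega)
  all_goals simp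

theorem g_braid {m k : ℕ} (h : k + 1 < m) :
    g m (k + 1) * (g m k * g m (k + 1)) = g m k * (g m (k + 1) * g m k) := by
  rw [g_eq h, g_eq (show k < m by omega)]
  exact s_braid (.inr rfl)

theorem len_g {m k : ℕ} (h : k < m) : len (g m k) = 1 := by rw [g_eq h, len_s]

theorem rv_g (m k : ℕ) : rv (g m k) = g m k := by
  unfold g; split_ifs <;> rfl

/-- `g (k-1) ⋯ g 0` -/
def dd (m : ℕ) : ℕ → M m
  | 0 => 1
  | k + 1 => g m k * dd m k

/-- `g k ⋯ g 1` -/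
def dd1 (m : ℕ) : ℕ → M m
  | 0 => 1
  | k + 1 => g m (k + 1) * dd1 m k

/-- `g 0 ⋯ g (k-1)` -/
def dl (m : ℕ) : ℕ → M m
  | 0 => 1
  | k + 1 => dl m k * g m k

/-- Garside element -/
def De (m : ℕ) : ℕ → M m
  | 0 => 1
  | k + 1 => De m k * dd m (k + 1)

theorem rv_dd (m k : ℕ) : rv (dd m k) = dl m k := by
  induction k with
  | zero => rfl
  | succ k ih => rw [dd, rv_mul, ih, rv_g, dl]

theorem dd_succ (m k : ℕ) : dd m (k + 1) = dd1 m k * g m 0 := by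
  induction k with
  | zero => simp [dd, dd1]
  | succ k ih => rw [dd, ih, dd1, mul_assoc]

theorem dd_comm {m k l : ℕ} (h : k + 1 ≤ l) : Commute (g m l) (dd m k) := by
  induction k with
  | zero => exact Commute.one_right _
  | succ k ih => exact Commute.mul_right (g_comm (by omega)).symm (ih (by omega))

theorem De_comm {m k l : ℕ} (h : k + 1 ≤ l) : Commute (g m l) (De m k) := by
  induction k with
  | zero => exact Commute.one_right _
  | succ k ih => exact Commute.mul_right (ih (by omega)) (dd_comm (by omega))

theorem dd_shift {m k i : ℕ} (hi : i + 1 < k) (hk : k ≤ m) :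
    dd m k * g m (i + 1) = g m i * dd m k := by
  induction k with
  | zero => omega
  | succ k ih =>
    rcases Nat.lt_or_ge (i + 1) k with h | h
    · rw [dd, mul_assoc, ih h (by omega), ← mul_assoc, ← g_comm (by omega), mul_assoc]
    · obtain rfl : k = i + 1 := by omega
      rw [dd, dd, mul_assoc, mul_assoc, ← (dd_comm (le_refl (i + 1))).eq, ← mul_assoc (g m i),
        ← mul_assoc, g_braid (by omega)]
      simp only [mul_assoc]

theorem dd_dd1 {m k j : ℕ} (hj : j ≤ k) (hk : k + 1 ≤ m) :
    dd m (k + 1) * dd1 m j = dd m j * dd m (k + 1) := by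
  induction j with
  | zero => simp [dd1, dd]
  | succ j ih =>
    rw [dd1, ← mul_assoc, dd_shift (by omega) hk, mul_assoc, ih (by omega), ← mul_assoc, show dd m (j + 1) = g m j * dd m j from rfl]

theorem dd_E {m k : ℕ} (hk : k + 1 ≤ m) :
    dd m k * dd m (k + 1) * g m 0 = dd m (k + 1) * dd m (k + 1) := by
  rw [← dd_dd1 le_rfl hk, mul_assoc, ← dd_succ]

theorem dd_sq {m k : ℕ} (hk : k + 1 ≤ m) :
    dd m (k + 1) * dd m (k + 1) * g m 0 = g m k * (dd m (k + 1) * dd m (k + 1)) := by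
  rw [← dd_E hk, show dd m (k + 1) = g m k * dd m k from rfl]
  have h := dd_E hk
  rw [show dd m (k + 1) = g m k * dd m k from rfl] at h
  rw [h]
  simp only [mul_assoc] at h ⊢
  rw [h]

theorem dl_shift {m k i : ℕ} (hi : i + 1 < k) (hk : k ≤ m) :
    dl m k * g m i = g m (i + 1) * dl m k := by
  have := congrArg rv (dd_shift hi hk)
  rw [rv_mul, rv_mul, rv_dd, rv_g, rv_g] at this
  exact this.symm

theorem dl_sq {m k : ℕ} (hk : k + 1 ≤ m) :
    (dl m (k + 1) * dl m (k + 1)) * g m k = g m 0 * (dl m (k + 1) * dl m (k + 1)) := by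
  have := congrArg rv (dd_sq hk)
  simp only [rv_mul, rv_dd, rv_g] at this
  exact this.symm

theorem dl_pow_shift {m i : ℕ} (j : ℕ) (hi : i + j < m) :
    dl m m ^ j * g m i = g m (i + j) * dl m m ^ j := by
  induction j with
  | zero => simp
  | succ j ih =>
    rw [pow_succ', mul_assoc, ih (by omega), ← mul_assoc, dl_shift (by omega) le_rfl, mul_assoc]
    rfl

/-- the full twist -/
def D (m : ℕ) : M m := dl m m ^ (m + 1)

theorem D_comm_g {m i : ℕ} (hi : i < m) : D m * g m i = g m i * D m := by
  obtain ⟨j, rfl⟩ : ∃ j, m = i + j + 1 := ⟨m - i - 1, by omega⟩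
  have h1 := dl_pow_shift (m := i + j + 1) (i := i) j (by omega)
  have h2 := dl_sq (m := i + j + 1) (k := i + j) le_rfl
  have h3 := dl_pow_shift (m := i + j + 1) (i := 0) i (by omega)
  rw [Nat.zero_add] at h3
  unfold D
  generalize dl (i + j + 1) (i + j + 1) = x at *
  rw [show i + j + 1 + 1 = i + 2 + j by omega, pow_add, mul_assoc, h1, pow_add, pow_two, mul_assoc,
    ← mul_assoc (x * x), h2, mul_assoc (g _ 0), ← mul_assoc (x ^ i), h3]
  simp only [mul_assoc]

theorem D_comm {m : ℕ} (x : M m) : D m * x = x * D m := by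
  induction x using M_ind with
  | h1 => simp
  | h i x ih => rw [← mul_assoc, s_eq_g, D_comm_g i.2, mul_assoc, ih, mul_assoc]

theorem dl_dvd (m k : ℕ) : ∃ y, dl m (k + 1) = g m 0 * y := by
  induction k with
  | zero => exact ⟨1, by simp [dl]⟩
  | succ k ih =>
    obtain ⟨y, hy⟩ := ih
    exact ⟨y * g m (k + 1), by rw [dl, hy, mul_assoc]⟩

theorem D_dvd {m : ℕ} (i : Fin m) : ∃ y, D m = s i * y := by
  obtain ⟨i, hi⟩ := i
  rw [s_eq_g]
  simp only
  obtain ⟨j, rfl⟩ : ∃ j, m = i + j + 1 := ⟨m - i - 1, by omega⟩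
  have h3 := dl_pow_shift (m := i + j + 1) (i := 0) i (by omega)
  rw [Nat.zero_add] at h3
  obtain ⟨y, hy⟩ := dl_dvd (i + j + 1) (i + j)
  unfold D
  generalize dl (i + j + 1) (i + j + 1) = x at *
  refine ⟨x ^ i * (y * x ^ (j + 1)), ?_⟩
  rw [show i + j + 1 + 1 = i + (1 + (j + 1)) by omega, pow_add, pow_add, pow_one, ← mul_assoc,
    ← mul_assoc, ← h3]
  nth_rw 2 [hy]
  simp only [mul_assoc]

theorem D_dvd' {m : ℕ} (i : Fin m) : ∃ y, D m = y * s i := by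
  obtain ⟨y, hy⟩ := D_dvd i
  refine ⟨y, cancel_left (s i) ?_⟩
  rw [← D_comm, ← mul_assoc, ← hy]

theorem exists_mul_eq_D_pow {m : ℕ} (x : M m) : ∃ y k, y * x = D m ^ k := by
  induction x using M_ind with
  | h1 => exact ⟨1, 0, by simp⟩
  | h i x ih =>
    obtain ⟨y, k, h⟩ := ih
    obtain ⟨c, hc⟩ := D_dvd' i
    refine ⟨y * c, k + 1, ?_⟩
    rw [mul_assoc, ← mul_assoc c, ← hc, D_comm, ← mul_assoc, h, pow_succ]

theorem D_pow_comm {m : ℕ} (k : ℕ) (x : M m) : D m ^ k * x = x * D m ^ k :=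
  ((show Commute (D m) x from D_comm x).pow_left k).eq

/-! ### The Garside element -/

theorem De_flip {m k : ℕ} (hk : k ≤ m) : ∀ {i j : ℕ}, i + j + 1 = k →
    De m k * g m i = g m j * De m k := by
  induction k with
  | zero => intro i j h; omega
  | succ k ih =>
    intro i j h
    cases i with
    | succ i =>
      rw [De, mul_assoc, dd_shift (by omega) hk, ← mul_assoc, ih (by omega) (j := j) (by omega),
        mul_assoc]
    | zero =>
      obtain rfl : j = k := by omega
      cases j with
      | zero => simp [De, dd]
      | succ k =>
        have := dd_E (m := m) (k := k + 1) hk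
        rw [De, De, mul_assoc, mul_assoc, ← mul_assoc (dd m (k + 1)), this]
        nth_rw 1 [dd]
        simp only [mul_assoc]
        rw [← mul_assoc, ← mul_assoc, ← (De_comm (le_refl (k + 1))).eq]
        simp only [mul_assoc]

theorem g_dvd_A {m i l : ℕ} {z : M m} (h : i + 2 ≤ l) (hl : l < m) (hd : g m l ∣ g m i * z) :
    g m l ∣ z := by
  obtain ⟨c, hc⟩ := hd
  rw [g_eq hl, g_eq (show i < m by omega)] at *
  obtain ⟨t, ht, _⟩ := (key hc).com (by simp; omega) (by unfold adj; simp only; omega)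
  exact ⟨t, ht⟩

theorem g_dvd_dd {m l : ℕ} (hl : l < m) : ∀ {k : ℕ} {z : M m}, k + 1 ≤ l →
    g m l ∣ dd m k * z → g m l ∣ z := by
  intro k
  induction k with
  | zero => intro z _ h; simpa [dd] using h
  | succ k ih =>
    intro z hk h
    rw [dd, mul_assoc] at h
    exact ih (by omega) (g_dvd_A (by omega) hl h)

theorem g_dvd_De {m l : ℕ} (hl : l < m) : ∀ {k : ℕ} {z : M m}, k + 1 ≤ l →
    g m l ∣ De m k * z → g m l ∣ z := by
  intro k
  induction k with
  | zero => intro z _ h; simpa [De] using h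
  | succ k ih =>
    intro z hk h
    rw [De, mul_assoc] at h
    exact g_dvd_dd hl hk (ih (by omega) h)

theorem dd_dvd {m : ℕ} : ∀ {l : ℕ} {y : M m}, l < m → g m l ∣ dd m l * y → dd m (l + 1) ∣ y := by
  intro l
  induction l with
  | zero => intro y _ h; simpa [dd] using h
  | succ l ih =>
    intro y hl h
    obtain ⟨c, hc⟩ := h
    rw [dd, mul_assoc, g_eq hl, g_eq (show l < m by omega)] at hc
    obtain ⟨z, hz, _⟩ := (key hc).brd (.inl rfl)
    rw [← g_eq hl, ← g_eq (show l < m by omega)] at hz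
    obtain ⟨y1, rfl⟩ := g_dvd_dd hl (le_refl (l + 1)) ⟨_, hz⟩
    rw [← mul_assoc, ← (dd_comm (le_refl (l + 1))).eq, mul_assoc] at hz
    obtain ⟨t, rfl⟩ := ih (by omega) ⟨_, cancel_left _ hz⟩
    exact ⟨t, (mul_assoc _ _ _).symm⟩

theorem De_dvd {m k : ℕ} (hk : k ≤ m) {x : M m} (h : ∀ i < k, g m i ∣ x) : De m k ∣ x := by
  induction k with
  | zero => exact ⟨x, by simp [De]⟩
  | succ k ih =>
    obtain ⟨y, rfl⟩ := ih (by omega) (fun i hi => h i (by omega))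
    have h1 : dd m (k + 1) ∣ y := by
      apply dd_dvd (by omega)
      have := h k (by omega)
      cases k with
      | zero => simpa [De, dd] using this
      | succ k =>
        rw [De, mul_assoc] at this
        exact g_dvd_De (by omega) le_rfl this
    obtain ⟨t, rfl⟩ := h1
    exact ⟨t, by rw [De, mul_assoc]⟩

theorem len_dd {m k : ℕ} (hk : k ≤ m) : len (dd m k) = k := by
  induction k with
  | zero => rfl
  | succ k ih => rw [dd, len_mul, ih (by omega), len_g (by omega)]; omega

theorem len_dl {m k : ℕ} (hk : k ≤ m) : len (dl m k) = k := by
  induction k with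
  | zero => rfl
  | succ k ih => rw [dl, len_mul, ih (by omega), len_g (by omega)]

theorem len_pow {m : ℕ} (x : M m) (k : ℕ) : len (x ^ k) = k * len x := by
  induction k with
  | zero => simp [len_one]
  | succ k ih => rw [pow_succ, len_mul, ih]; ring

theorem len_D (m : ℕ) : len (D m) = (m + 1) * m := by rw [D, len_pow, len_dl le_rfl]

theorem len_De {m k : ℕ} (hk : k ≤ m) : 2 * len (De m k) = (k + 1) * k := by
  induction k with
  | zero => rfl
  | succ k ih => rw [De, len_mul, mul_add, ih (by omega), len_dd hk]; ring

/-- quasi-central elements -/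
def T {m : ℕ} (x : M m) : Prop := ∃ f : Fin m → Fin m, ∀ i, s i * x = x * s (f i)

theorem T.step {m : ℕ} {x : M m} (h : T x) {i j : Fin m} (ha : adj i j) (hi : s i ∣ x) :
    s j ∣ x := by
  obtain ⟨f, hf⟩ := h
  obtain ⟨y, rfl⟩ := hi
  have h1 := hf j
  rw [mul_assoc] at h1
  obtain ⟨z, hz, _⟩ := (key h1).brd (adj_symm ha)
  have hy := cancel_left _ hz
  have h2 := hf i
  rw [mul_assoc] at h2
  have h3 := cancel_left _ h2
  exact ⟨z * s (f i), by rw [h3, hy, mul_assoc]⟩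

theorem T.all {m : ℕ} {x : M m} (h : T x) (hx : x ≠ 1) : ∀ k < m, g m k ∣ x := by
  rcases eq_one_or x with h1 | ⟨i, y, hy⟩
  · exact (hx h1).elim
  have up : ∀ k, k + 1 < m → g m k ∣ x → g m (k + 1) ∣ x := by
    intro k hk hd
    rw [g_eq hk]
    rw [g_eq (show k < m by omega)] at hd
    exact h.step (.inl rfl) hd
  have dn : ∀ k, k + 1 < m → g m (k + 1) ∣ x → g m k ∣ x := by
    intro k hk hd
    rw [g_eq hk] at hd
    rw [g_eq (show k < m by omega)]
    exact h.step (.inr rfl) hd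
  have z : ∀ k, k < m → g m k ∣ x → g m 0 ∣ x := by
    intro k
    induction k with
    | zero => exact fun _ h => h
    | succ k ih => exact fun hk hd => ih (by omega) (dn k hk hd)
  have h0 := z i i.2 (by rw [← s_eq_g]; exact ⟨y, hy⟩)
  intro k
  induction k with
  | zero => exact fun _ => h0
  | succ k ih => exact fun hk => up k hk (ih (by omega))

theorem De_flip_s {m : ℕ} (i : Fin m) : s i * De m m = De m m * s i.rev := by
  rw [s_eq_g, s_eq_g, De_flip le_rfl (j := i)]
  rw [Fin.val_rev]; omega

theorem T.eq_pow {m : ℕ} (hm : 1 ≤ m) : ∀ (N : ℕ) {x : M m}, len x ≤ N → T x →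
    ∃ k, x = De m m ^ k := by
  intro N
  induction N with
  | zero =>
    intro x hl _
    rcases eq_one_or x with h1 | ⟨i, y, rfl⟩
    · exact ⟨0, by simpa using h1⟩
    · rw [len_mul, len_s] at hl; omega
  | succ N ih =>
    intro x hl h
    by_cases h1 : x = 1
    · exact ⟨0, by simpa using h1⟩
    obtain ⟨y, rfl⟩ := De_dvd le_rfl (h.all h1)
    have l := len_De (le_refl m)
    have : 1 ≤ (m + 1) * m := Nat.mul_pos (by omega) hm
    rw [len_mul] at hl
    obtain ⟨f, hf⟩ := h
    obtain ⟨k, rfl⟩ := ih (x := y) (by omega) ⟨fun i => f i.rev, fun i => by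
      apply cancel_left (De m m)
      rw [← mul_assoc, ← mul_assoc, ← hf, ← mul_assoc, De_flip_s, Fin.rev_rev]⟩
    exact ⟨k + 1, by rw [pow_succ']⟩

theorem s_inj {m : ℕ} {i j : Fin m} (h : s i = s j) : i = j := by
  by_contra hij
  have h' : s i * 1 = s j * 1 := by rw [h]
  rcases key h' with ⟨h, _⟩ | ⟨_, _, z, hz, _⟩ | ⟨_, z, hz, _⟩
  · exact hij h
  all_goals
    have := congrArg len hz
    simp only [len_mul, len_one, len_s] at this
    omega

theorem De_sq_comm {m : ℕ} (i : Fin m) : Commute (De m m ^ 2) (s i) := by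
  rw [pow_two]
  change _ = _
  rw [← mul_assoc, De_flip_s, mul_assoc (De m m) (s i.rev), De_flip_s, Fin.rev_rev, mul_assoc]

theorem central_even {m : ℕ} (hm : 2 ≤ m) {x : M m} (h : ∀ i, s i * x = x * s i) :
    ∃ k, x = (De m m ^ 2) ^ k := by
  obtain ⟨k, rfl⟩ := T.eq_pow (by omega) _ le_rfl ⟨id, h⟩
  rcases Nat.even_or_odd' k with ⟨j, rfl | rfl⟩
  · exact ⟨j, by rw [pow_mul]⟩
  · exfalso
    have h0 := h ⟨0, by omega⟩
    rw [pow_succ, ← mul_assoc, pow_mul, ← ((De_sq_comm _).pow_left j).eq, mul_assoc, mul_assoc,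
      De_flip_s] at h0
    have := s_inj (cancel_left _ (cancel_left _ h0))
    simp [Fin.ext_iff] at this
    omega

theorem D_eq {m : ℕ} (hm : 2 ≤ m) : D m = De m m ^ 2 := by
  obtain ⟨k, hk⟩ := central_even hm (x := D m) (fun i => (D_comm _).symm)
  have l := congrArg len hk
  rw [len_D, len_pow, len_pow, len_De le_rfl] at l
  have : 0 < (m + 1) * m := by positivity
  have : k = 1 := by nlinarith
  rw [hk, this, pow_one]

theorem central_pow {m : ℕ} (hm : 2 ≤ m) {x : M m} (h : ∀ i, s i * x = x * s i) :
    ∃ k, x = D m ^ k := by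
  rw [D_eq hm]; exact central_even hm h

/-! ### Passage to the group -/

noncomputable instance oreSet (m : ℕ) : OreLocalization.OreSet (⊤ : Submonoid (M m)) where
  ore_right_cancel r₁ r₂ t h := ⟨1, by rw [cancel_right _ h]⟩
  oreNum r t := r * (exists_mul_eq_D_pow (t : M m)).choose
  oreDenom _ t := ⟨D m ^ (exists_mul_eq_D_pow (t : M m)).choose_spec.choose, trivial⟩
  ore_eq r t := by
    have h := (exists_mul_eq_D_pow (t : M m)).choose_spec.choose_spec
    exact (D_pow_comm _ r).trans ((congrArg (r * ·) h.symm).trans (mul_assoc _ _ _).symm)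

/-- the group of units of the localization -/
abbrev U (m : ℕ) : Type := (OreLocalization (⊤ : Submonoid (M m)) (M m))ˣ

/-- positive braids as units of the localization -/
noncomputable def toU (m : ℕ) (x : M m) : U m :=
  OreLocalization.numeratorUnit (⟨x, trivial⟩ : (⊤ : Submonoid (M m)))

theorem toU_val {m : ℕ} (x : M m) : ((toU m x : U m) : OreLocalization (⊤ : Submonoid (M m)) (M m))
    = OreLocalization.numeratorHom x := rfl

theorem toU_mul {m : ℕ} (x y : M m) : toU m (x * y) = toU m x * toU m y := by
  apply Units.ext
  rw [Units.val_mul, toU_val, toU_val, toU_val, map_mul]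

theorem toU_one {m : ℕ} : toU m 1 = 1 := by
  apply Units.ext
  rw [toU_val, map_one, Units.val_one]

theorem toU_inj {m : ℕ} {x y : M m} (h : toU m x = toU m y) : x = y := by
  have h' := congrArg Units.val h
  rw [toU_val, toU_val] at h'
  change x /ₒ (1 : (⊤ : Submonoid (M m))) = y /ₒ (1 : (⊤ : Submonoid (M m))) at h'
  rw [OreLocalization.oreDiv_eq_iff] at h'
  obtain ⟨u, v, h1, h2⟩ := h'
  have h3 : (u : M m) = v := by simpa using h2
  rw [← h3] at h1
  exact (cancel_left (u : M m) h1).symm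

/-- the group with `m` generators -/
abbrev G (m : ℕ) := PresentedGroup (braidRels m)

/-- group generators -/
def t {m : ℕ} (i : Fin m) : G m := PresentedGroup.of i

theorem t_comm {m : ℕ} {i j : Fin m} (h : (i : ℕ) + 2 ≤ j) : t i * t j = t j * t i := by
  have : (PresentedGroup.mk (braidRels m)) (.of i * .of j * (.of i)⁻¹ * (.of j)⁻¹) = 1 :=
    PresentedGroup.one_of_mem (.inl ⟨i, j, h, rfl⟩)
  rw [map_mul, map_mul, map_mul, map_inv, map_inv, mul_inv_eq_one, mul_inv_eq_iff_eq_mul] at this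
  exact this

theorem t_braid {m : ℕ} {i j : Fin m} (h : (i : ℕ) + 1 = j) :
    t i * t j * t i = t j * t i * t j := by
  have : (PresentedGroup.mk (braidRels m)) (.of i * .of j * .of i * (.of j * .of i * .of j)⁻¹) = 1 :=
    PresentedGroup.one_of_mem (.inr ⟨i, j, h, rfl⟩)
  rw [map_mul, map_inv, mul_inv_eq_one] at this
  simp only [map_mul] at this
  exact this

/-- positive braids in the braid group -/
def ph {m : ℕ} : M m → G m := Quotient.lift (fun u => (u.map t).prod) (by
  intro u v h
  change BEq u v at h
  induction h with
  | refl => rfl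
  | symm _ ih => exact ih.symm
  | trans _ _ ih1 ih2 => exact ih1.trans ih2
  | cons i _ ih => simp_all
  | comm i j u h => simp only [List.map_cons, List.prod_cons, ← mul_assoc, t_comm h]
  | braid i j u h => simp only [List.map_cons, List.prod_cons, ← mul_assoc, t_braid h])

theorem ph_mul {m : ℕ} (x y : M m) : ph (x * y) = ph x * ph y := by
  obtain ⟨u, rfl⟩ := mk_surj x
  obtain ⟨v, rfl⟩ := mk_surj y
  change ((u ++ v).map t).prod = (u.map t).prod * (v.map t).prod
  simp

theorem ph_one {m : ℕ} : ph (1 : M m) = 1 := rfl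

theorem ph_s {m : ℕ} (i : Fin m) : ph (s i) = t i := by
  change ([i].map t).prod = _
  simp

theorem ph_pow {m : ℕ} (x : M m) (k : ℕ) : ph (x ^ k) = ph x ^ k := by
  induction k with
  | zero => simp [ph_one]
  | succ k ih => rw [pow_succ, ph_mul, ih, pow_succ]

theorem rels_toU {m : ℕ} : ∀ r ∈ braidRels m, FreeGroup.lift (fun i => toU m (s i)) r = 1 := by
  rintro r (⟨i, j, h, rfl⟩ | ⟨i, j, h, rfl⟩)
  · rw [map_mul, map_mul, map_mul, map_inv, map_inv, mul_inv_eq_one, mul_inv_eq_iff_eq_mul]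
    simp only [FreeGroup.lift_apply_of, ← toU_mul]
    rw [s_comm (by unfold adj; omega)]
  · rw [map_mul, map_inv, mul_inv_eq_one]
    simp only [map_mul, FreeGroup.lift_apply_of, ← toU_mul]
    rw [mul_assoc, s_braid (.inl h), mul_assoc]

theorem toGroup_ph {m : ℕ} (x : M m) : PresentedGroup.toGroup rels_toU (ph x) = toU m x := by
  induction x using M_ind with
  | h1 => rw [ph_one, map_one, toU_one]
  | h i x ih => rw [ph_mul, map_mul, ih, toU_mul, ph_s, t, PresentedGroup.toGroup.of]

theorem ph_inj {m : ℕ} {x y : M m} (h : ph x = ph y) : x = y := by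
  apply toU_inj
  rw [← toGroup_ph, h, toGroup_ph]

theorem ph_D_mem {m : ℕ} : ph (D m) ∈ Subgroup.center (G m) := by
  have : Subgroup.centralizer {ph (D m)} = ⊤ := by
    rw [eq_top_iff, ← PresentedGroup.closure_range_of, Subgroup.closure_le]
    rintro _ ⟨i, rfl⟩
    change t i ∈ Subgroup.centralizer {ph (D m)}
    rw [Subgroup.mem_centralizer_singleton_iff, ← ph_s, ← ph_mul, ← ph_mul, D_comm]
  rw [Subgroup.mem_center_iff]
  intro x
  have hx : x ∈ Subgroup.centralizer {ph (D m)} := by rw [this]; trivial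
  exact Subgroup.mem_centralizer_singleton_iff.1 hx

theorem exists_frac {m : ℕ} (x : G m) : ∃ (k : ℕ) (y : M m), ph (D m) ^ k * x = ph y := by
  have hx : x ∈ Subgroup.closure (Set.range (PresentedGroup.of (rels := braidRels m))) := by
    rw [PresentedGroup.closure_range_of]; trivial
  have hc : ∀ (k : ℕ) (z : G m), z * ph (D m) ^ k = ph (D m) ^ k * z := fun k =>
    Subgroup.mem_center_iff.1 (Subgroup.pow_mem _ ph_D_mem k)
  have hmul : ∀ a b : G m, (∃ (k : ℕ) (y : M m), ph (D m) ^ k * a = ph y) →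
      (∃ (k : ℕ) (y : M m), ph (D m) ^ k * b = ph y) →
      ∃ (k : ℕ) (y : M m), ph (D m) ^ k * (a * b) = ph y := by
    rintro a b ⟨k, y, h⟩ ⟨l, z, h'⟩
    refine ⟨k + l, y * z, ?_⟩
    rw [ph_mul, ← h, ← h', pow_add, mul_assoc, mul_assoc, ← mul_assoc a, hc l a, mul_assoc]
  induction hx using Subgroup.closure_induction'' with
  | one => exact ⟨0, 1, by simp [ph_one]⟩
  | mem x hx =>
    obtain ⟨i, rfl⟩ := hx
    exact ⟨0, s i, by rw [pow_zero, one_mul, ph_s]; rfl⟩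
  | inv_mem x hx =>
    obtain ⟨i, rfl⟩ := hx
    obtain ⟨y, hy⟩ := D_dvd' i
    refine ⟨1, y, ?_⟩
    change _ * (t i)⁻¹ = _
    rw [pow_one, hy, ph_mul, ph_s, mul_inv_cancel_right]
  | mul x y _ _ hx hy => exact hmul x y hx hy

theorem center_eq {m : ℕ} (hm : 2 ≤ m) :
    Subgroup.center (G m) = Subgroup.zpowers (ph (D m)) := by
  apply le_antisymm
  · intro x hx
    obtain ⟨k, y, h⟩ := exists_frac x
    have hy : ph y ∈ Subgroup.center (G m) := by
      rw [← h]; exact Subgroup.mul_mem _ (Subgroup.pow_mem _ ph_D_mem k) hx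
    obtain ⟨l, rfl⟩ := central_pow hm (x := y) (fun i => by
      apply ph_inj
      rw [ph_mul, ph_mul]
      exact Subgroup.mem_center_iff.1 hy _)
    rw [ph_pow] at h
    have e : x = (ph (D m) ^ k)⁻¹ * ph (D m) ^ l := by rw [← h, inv_mul_cancel_left]
    rw [e]
    have hD : ph (D m) ∈ Subgroup.zpowers (ph (D m)) := Subgroup.mem_zpowers _
    exact Subgroup.mul_mem _ (Subgroup.inv_mem _ (Subgroup.pow_mem _ hD k))
      (Subgroup.pow_mem _ hD l)
  · rw [Subgroup.zpowers_le]
    exact ph_D_mem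

theorem ph_dl (n k : ℕ) : ph (dl (n - 1) k) =
    (((List.range k).map (fun i => σ n (i + 1))).prod) := by
  induction k with
  | zero => rfl
  | succ k ih =>
    rw [List.range_succ, List.map_append, List.prod_append, dl, ph_mul, ih]
    congr 1
    simp only [List.map_cons, List.map_nil, List.prod_cons, List.prod_nil, mul_one]
    unfold g σ
    by_cases h : k < n - 1
    · rw [dif_pos h, dif_pos (by simpa using h), ph_s]; rfl
    · rw [dif_neg h, dif_neg (by simpa using h), ph_one]

end BG

/-- For `n ≥ 3`, the Garside element `Δ² = (σ_1 σ_2 ⋯ σ_{n-1})^n` generates the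
center of the braid group `B_n`. -/
theorem center_braidGroup (n : ℕ) (hn : 3 ≤ n) :
    Subgroup.center (braidGroup n) =
      Subgroup.zpowers ((((List.range (n - 1)).map (fun i => σ n (i + 1))).prod) ^ n) := by
  rw [← BG.ph_dl, BG.center_eq (m := n - 1) (by omega), BG.D, BG.ph_pow,
    show n - 1 + 1 = n by omega]
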